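/- The set of periodic points of the map f(φ) = 2φ − π on the additive circle ℝ/(2πℤ) (points φ such that the n-th iterate of f fixes φ for some n ≥ 1) is dense in the circle. -/

import Mathlib

/-- On a circle of positive length, the points fixed by multiplication by some positive power
of `m ≥ 2` are dense. -/
theorem AddCircle.dense_setOf_exists_pow_nsmul_eq {p : ℝ} (hp : 0 < p) {m : ℕ} (hm : 1 < m) :
    Dense {ψ : AddCircle p | ∃ n : ℕ, 1 ≤ n ∧ m ^ n • ψ = ψ} := by
  rw [← QuotientAddGroup.dense_preimage_mk]
  refine dense_of_exists_between fun a b hab => ?_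
  have hba : 0 < b - a := sub_pos.2 hab
  obtain ⟨n, hn⟩ := pow_unbounded_of_one_lt (p / (b - a) + 1) (Nat.one_lt_cast (α := ℝ).2 hm)
  have hpos : 0 < p / (b - a) := div_pos hp hba
  have hn0 : n ≠ 0 := by
    rintro rfl
    rw [pow_zero] at hn
    linarith
  have hd : 0 < (m : ℝ) ^ n - 1 := by linarith
  set δ : ℝ := p / ((m : ℝ) ^ n - 1) with hδ
  have hδpos : 0 < δ := div_pos hp hd
  have hδlt : δ < b - a := by
    rw [hδ, div_lt_comm₀ hd hba]
    linarith
  have hmul : (m : ℝ) ^ n * δ = δ + p := by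
    rw [hδ]
    field_simp
    ring
  set k : ℤ := ⌊a / δ⌋ + 1 with hk
  have hlow : a < k * δ := by
    rw [← div_lt_iff₀ hδpos, hk]
    exact_mod_cast Int.lt_floor_add_one (a / δ)
  have hup : k * δ ≤ a + δ := by
    have h := (le_div_iff₀ hδpos).1 (Int.floor_le (a / δ))
    rw [hk]
    push_cast
    linarith
  refine ⟨k * δ, ⟨n, Nat.one_le_iff_ne_zero.2 hn0, ?_⟩, hlow, by linarith⟩
  change m ^ n • ((k * δ : ℝ) : AddCircle p) = ((k * δ : ℝ) : AddCircle p)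
  rw [← AddCircle.coe_nsmul, ← sub_eq_zero, ← AddCircle.coe_sub, AddCircle.coe_eq_zero_iff]
  refine ⟨k, ?_⟩
  rw [zsmul_eq_mul, nsmul_eq_mul]
  push_cast
  linear_combination -(k : ℝ) * hmul

/-- The iterates of `x ↦ 2x - c`, written in terms of the displacement from its fixed point `c`. -/
theorem iterate_two_zsmul_sub {G : Type*} [AddCommGroup G] {f : G → G} {c : G}
    (hf : ∀ x, f x = (2 : ℤ) • x - c) (n : ℕ) (x : G) :
    f^[n] x = 2 ^ n • (x - c) + c := by
  induction n with
  | zero => simp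
  | succ n ih =>
    rw [Function.iterate_succ_apply', ih, hf, pow_succ', mul_nsmul']
    abel

/-- The set of periodic points of the map f(φ) = 2φ − π on the additive circle
ℝ/(2πℤ) is dense in the circle. -/
theorem bernoulli_map_periodic_points_dense
    (f : AddCircle (2 * Real.pi) → AddCircle (2 * Real.pi))
    (hf : ∀ φ, f φ = (2 : ℤ) • φ - ((Real.pi : ℝ) : AddCircle (2 * Real.pi))) :
    Dense {φ : AddCircle (2 * Real.pi) | ∃ n : ℕ, 1 ≤ n ∧ f^[n] φ = φ} := by
  have h := (AddCircle.dense_setOf_exists_pow_nsmul_eq Real.two_pi_pos one_lt_two).preimage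
    (Homeomorph.subRight ((Real.pi : ℝ) : AddCircle (2 * Real.pi))).isOpenMap
  refine h.mono ?_
  rintro φ ⟨n, hn, hφ⟩
  refine ⟨n, hn, ?_⟩
  rw [iterate_two_zsmul_sub hf, ← eq_sub_iff_add_eq]
  exact hφ
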